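/- (Lemma mpw2.) Fix k ≥ 3, set B = C(k, ⌊k/2⌋), let T be a bijection from {1, …, B} to the family of ⌊k/2⌋-element subsets of Fin k, let φ be a CSP instance over domain {1, …, B} with variables x_1, …, x_n and constraints c_0, …, c_{m−1} each having a nonempty set S_j of satisfying assignments, and let G(φ) be the list-coloring instance built from φ as follows. Vertices and lists: for each i, a clique V_i of ⌊k/2⌋ vertices with full lists {1, …, k}; for each j, an OR(S_j) gadget whose non-internal vertices are indexed by the assignments a ∈ S_j and have lists {1,2,3}, together with its |S_j|+1 internal path vertices with lists as in the OR gadget definition; for each j, each a ∈ S_j, and each variable x_i ∈ var(c_j), a set U_i^{j,a} of ⌈k/2⌉ vertices with full lists, and for each color c ∈ Fin k \ T(a(x_i)) the internal vertices of a (1→c)-implication gadget from the vertex of S_j representing a to a distinct vertex of U_i^{j,a}. Edges: the clique edges inside each V_i; the OR-gadget path edges; the weak-edge path edges inside each implication gadget (whose internal vertices have no other neighbors); and all edges between every vertex of U_i^{j,a} and every vertex of V_i. Then: if G(φ) admits a proper list coloring, φ has a satisfying assignment. -/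

import Mathlib

namespace Mpw

/- Throughout, the number of colors is `k = K + 3 ≥ 3`, and the paper's colors
`1, 2, 3` are `0, 1, 2 : Fin (K + 3)`. -/

variable (K n m B : ℕ)
variable (T : Fin B ≃ {s : Finset (Fin (K + 3)) // s.card = (K + 3) / 2})
variable (S : Fin m → Finset (Fin n → Fin B)) (vr : Fin m → Finset (Fin n))

/-- First color different from `c` (used in the `c1 = c2` weak-edge lists). -/
def aux1 (c : Fin (K + 3)) : Fin (K + 3) := if c = 0 then 1 else 0

/-- Second color different from `c` and from `aux1 c`. -/
def aux2 (c : Fin (K + 3)) : Fin (K + 3) := if c = 0 ∨ c = 1 then 2 else 1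

/-- A color outside `{c1, c2}` (used in the `c1 ≠ c2` weak-edge lists). -/
def auxc (c1 c2 : Fin (K + 3)) : Fin (K + 3) :=
  if c1 ≠ 0 ∧ c2 ≠ 0 then 0 else if c1 ≠ 1 ∧ c2 ≠ 1 then 1 else 2

/-- The lists of the three internal vertices of a `(c1,c2)`-weak edge. -/
def wlist (c1 c2 : Fin (K + 3)) : Fin 3 → Finset (Fin (K + 3)) :=
  if c1 = c2 then ![{c1, aux1 K c1}, {aux1 K c1, aux2 K c1}, {c1, aux2 K c1}]
  else ![{c1, c2}, {c2, auxc K c1 c2}, {c2, auxc K c1 c2}]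

/-- The `r`-th color of `Fin (K+3) \ T (a i)`: the color of the `r`-th vertex of
`U_i^{j,a}` forced by the implication gadgets when the vertex of the OR gadget
representing the assignment `a` receives color `1` (here `0`). -/
def target (a : Fin n → Fin B) (i : Fin n) (r : Fin ((K + 3) - (K + 3) / 2)) :
    Fin (K + 3) :=
  ((((T (a i) : Finset (Fin (K + 3)))ᶜ).orderIsoOfFin
      (by simp [Finset.card_compl, (T (a i)).2])) r : Fin (K + 3))

/-- The vertices of `G(φ)`: the cliques `V_i`; the OR-gadget vertices `s` indexed by the
satisfying assignments `a ∈ S j`; the internal OR-path vertices `t`; the sets `U_i^{j,a}`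
(of size `⌈k/2⌉ = k - ⌊k/2⌋`); and, for each vertex `U_i^{j,a}(r)` and each color
`c' ≠ target`, the three internal vertices of the `(1,c')`-weak edge of the
`(1 → target)`-implication gadget. -/
def MVert : Type :=
  (Fin n × Fin ((K + 3) / 2)) ⊕
  (Σ j : Fin m, {a : Fin n → Fin B // a ∈ S j}) ⊕
  (Σ j : Fin m, Fin ((S j).card + 1)) ⊕
  (Σ j : Fin m, Σ a : {a : Fin n → Fin B // a ∈ S j},
    {i : Fin n // i ∈ vr j} × Fin ((K + 3) - (K + 3) / 2)) ⊕
  (Σ j : Fin m, Σ a : {a : Fin n → Fin B // a ∈ S j}, Σ i : {i : Fin n // i ∈ vr j},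
    Σ r : Fin ((K + 3) - (K + 3) / 2),
      {c' : Fin (K + 3) // c' ≠ target K n B T a.1 i.1 r} × Fin 3)

/-- vertex of the clique `V_i`. -/
def vx (i : Fin n) (p : Fin ((K + 3) / 2)) : MVert K n m B T S vr := Sum.inl (i, p)

/-- OR-gadget vertex representing the satisfying assignment `a ∈ S j`. -/
def sx (j : Fin m) (a : {a : Fin n → Fin B // a ∈ S j}) : MVert K n m B T S vr :=
  Sum.inr (Sum.inl ⟨j, a⟩)

/-- internal vertex of the OR gadget of constraint `j`. -/
def tx (j : Fin m) (q : Fin ((S j).card + 1)) : MVert K n m B T S vr :=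
  Sum.inr (Sum.inr (Sum.inl ⟨j, q⟩))

/-- the `r`-th vertex of `U_i^{j,a}`. -/
def ux (j : Fin m) (a : {a : Fin n → Fin B // a ∈ S j}) (i : {i : Fin n // i ∈ vr j})
    (r : Fin ((K + 3) - (K + 3) / 2)) : MVert K n m B T S vr :=
  Sum.inr (Sum.inr (Sum.inr (Sum.inl ⟨j, a, i, r⟩)))

/-- the `p`-th internal vertex of the `(1,c')`-weak edge from `sx j a` to `ux j a i r`. -/
def wx (j : Fin m) (a : {a : Fin n → Fin B // a ∈ S j}) (i : {i : Fin n // i ∈ vr j})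
    (r : Fin ((K + 3) - (K + 3) / 2))
    (c' : {c' : Fin (K + 3) // c' ≠ target K n B T a.1 i.1 r}) (p : Fin 3) :
    MVert K n m B T S vr :=
  Sum.inr (Sum.inr (Sum.inr (Sum.inr ⟨j, a, i, r, c', p⟩)))

/-- The edges of `G(φ)` (to be symmetrized by `SimpleGraph.fromRel`): the clique edges
inside each `V_i`; the OR-gadget path edges (with the vertices of `S j` enumerated by
`(S j).equivFin.symm`); the weak-edge path edges of the implication gadgets; and all
edges between `U_i^{j,a}` and `V_i`. -/
def rel (x y : MVert K n m B T S vr) : Prop :=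
  (∃ (i : Fin n) (p p' : Fin ((K + 3) / 2)), p ≠ p' ∧
    x = vx K n m B T S vr i p ∧ y = vx K n m B T S vr i p') ∨
  (∃ (j : Fin m) (q : Fin (S j).card),
    x = tx K n m B T S vr j q.castSucc ∧ y = sx K n m B T S vr j ((S j).equivFin.symm q)) ∨
  (∃ (j : Fin m) (q : Fin (S j).card),
    x = sx K n m B T S vr j ((S j).equivFin.symm q) ∧ y = tx K n m B T S vr j q.succ) ∨
  (∃ (j : Fin m) (a : {a : Fin n → Fin B // a ∈ S j}) (i : {i : Fin n // i ∈ vr j})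
      (r : Fin ((K + 3) - (K + 3) / 2))
      (c' : {c' : Fin (K + 3) // c' ≠ target K n B T a.1 i.1 r}),
    x = sx K n m B T S vr j a ∧ y = wx K n m B T S vr j a i r c' 0) ∨
  (∃ (j : Fin m) (a : {a : Fin n → Fin B // a ∈ S j}) (i : {i : Fin n // i ∈ vr j})
      (r : Fin ((K + 3) - (K + 3) / 2))
      (c' : {c' : Fin (K + 3) // c' ≠ target K n B T a.1 i.1 r}),
    x = wx K n m B T S vr j a i r c' 0 ∧ y = wx K n m B T S vr j a i r c' 1) ∨
  (∃ (j : Fin m) (a : {a : Fin n → Fin B // a ∈ S j}) (i : {i : Fin n // i ∈ vr j})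
      (r : Fin ((K + 3) - (K + 3) / 2))
      (c' : {c' : Fin (K + 3) // c' ≠ target K n B T a.1 i.1 r}),
    x = wx K n m B T S vr j a i r c' 1 ∧ y = wx K n m B T S vr j a i r c' 2) ∨
  (∃ (j : Fin m) (a : {a : Fin n → Fin B // a ∈ S j}) (i : {i : Fin n // i ∈ vr j})
      (r : Fin ((K + 3) - (K + 3) / 2))
      (c' : {c' : Fin (K + 3) // c' ≠ target K n B T a.1 i.1 r}),
    x = wx K n m B T S vr j a i r c' 2 ∧ y = ux K n m B T S vr j a i r) ∨
  (∃ (j : Fin m) (a : {a : Fin n → Fin B // a ∈ S j}) (i : {i : Fin n // i ∈ vr j})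
      (r : Fin ((K + 3) - (K + 3) / 2)) (p : Fin ((K + 3) / 2)),
    x = ux K n m B T S vr j a i r ∧ y = vx K n m B T S vr i.1 p)

/-- The graph `G(φ)`. -/
def graph : SimpleGraph (MVert K n m B T S vr) :=
  SimpleGraph.fromRel (rel K n m B T S vr)

/-- The lists of `G(φ)`: full lists on the cliques `V_i` and the sets `U_i^{j,a}`,
`{1,2,3}` (here `{0,1,2}`) on the OR-gadget vertices `S j`, the OR-gadget internal lists
on the path vertices, and the weak-edge lists on the implication-gadget internals. -/
def lists : MVert K n m B T S vr → Finset (Fin (K + 3)) :=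
  Sum.elim (fun _ => Finset.univ) <|
  Sum.elim (fun _ => ({0, 1, 2} : Finset (Fin (K + 3)))) <|
  Sum.elim (fun z => if z.2 = 0 then {1}
    else if z.2 = Fin.last (S z.1).card then {2} else {1, 2}) <|
  Sum.elim (fun _ => Finset.univ) <|
  fun z => wlist K 0 z.2.2.2.2.1.1 z.2.2.2.2.2

/-- `σ` satisfies the CSP instance: for every constraint `j`, the restriction of `σ`
to `vr j` agrees with some satisfying assignment `a ∈ S j`. -/
def Satisfies (σ : Fin n → Fin B) : Prop :=
  ∀ j : Fin m, ∃ a ∈ S j, ∀ i ∈ vr j, σ i = a i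

section ProperColoring

variable {K n m B T S vr}

private lemma zero_ne_two : (0 : Fin (K + 3)) ≠ 2 := by
  simp [Fin.ext_iff, Nat.mod_eq_of_lt (show 2 < K + 3 by omega)]

private lemma one_ne_two : (1 : Fin (K + 3)) ≠ 2 := by
  simp [Fin.ext_iff, Nat.mod_eq_of_lt (show 2 < K + 3 by omega)]

/-- A `(0,c')`-weak edge whose first endpoint has color `0` forbids the color `c'` at its
second endpoint. -/
lemma ne_of_weakEdge {c' x₀ x₁ x₂ y : Fin (K + 3)}
    (h₀ : x₀ ∈ wlist K 0 c' 0) (h₁ : x₁ ∈ wlist K 0 c' 1) (h₂ : x₂ ∈ wlist K 0 c' 2)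
    (hs : 0 ≠ x₀) (h₀₁ : x₀ ≠ x₁) (h₁₂ : x₁ ≠ x₂) (hy : x₂ ≠ y) : y ≠ c' := by
  have h02 := zero_ne_two (K := K)
  by_cases hc : (0 : Fin (K + 3)) = c'
  · subst hc
    simp [wlist, aux1, aux2] at h₀ h₁ h₂
    grind
  · simp [wlist, hc] at h₀ h₁ h₂
    grind

lemma vx_injective (i : Fin n) : Function.Injective (vx K n m B T S vr i) :=
  fun _ _ h => congrArg Prod.snd (Sum.inl.inj h)

lemma wx_injective (j : Fin m) (a : {a : Fin n → Fin B // a ∈ S j}) (i : {i : Fin n // i ∈ vr j})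
    (r : Fin ((K + 3) - (K + 3) / 2))
    (c' : {c' : Fin (K + 3) // c' ≠ target K n B T a.1 i.1 r}) :
    Function.Injective (wx K n m B T S vr j a i r c') := fun p p' h => by
  have h := Sum.inr.inj (Sum.inr.inj (Sum.inr.inj (Sum.inr.inj h)))
  simpa using h

variable {c : MVert K n m B T S vr → Fin (K + 3)}

lemma ne_of_rel (hc : ∀ ⦃x y⦄, (graph K n m B T S vr).Adj x y → c x ≠ c y)
    {x y : MVert K n m B T S vr} (hne : x ≠ y) (h : rel K n m B T S vr x y) : c x ≠ c y :=
  hc <| (SimpleGraph.fromRel_adj _ _ _).2 ⟨hne, Or.inl h⟩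

/-- In a proper list coloring, some vertex of every nonempty OR gadget has color `0`. -/
lemma exists_sx_eq_zero (hl : ∀ v, c v ∈ lists K n m B T S vr v)
    (hc : ∀ ⦃x y⦄, (graph K n m B T S vr).Adj x y → c x ≠ c y)
    {j : Fin m} (hj : (S j).Nonempty) :
    ∃ a, c (sx K n m B T S vr j a) = 0 := by
  by_contra! hne
  have h12 := one_ne_two (K := K)
  have hpos := hj.card_pos
  have ht (q : Fin ((S j).card + 1)) : c (tx K n m B T S vr j q) = 1 := by
    induction q using Fin.induction with
    | zero => simpa [lists, tx] using hl (tx K n m B T S vr j 0)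
    | succ q ih =>
      have hsl : c (sx K n m B T S vr j ((S j).equivFin.symm q)) ∈
          ({0, 1, 2} : Finset (Fin (K + 3))) := hl (sx K n m B T S vr j _)
      have hs0 := hne ((S j).equivFin.symm q)
      have h₁ : c (tx K n m B T S vr j q.castSucc) ≠
          c (sx K n m B T S vr j ((S j).equivFin.symm q)) :=
        ne_of_rel hc nofun (Or.inr <| Or.inl ⟨j, q, rfl, rfl⟩)
      have h₂ : c (sx K n m B T S vr j ((S j).equivFin.symm q)) ≠
          c (tx K n m B T S vr j q.succ) :=
        ne_of_rel hc nofun (Or.inr <| Or.inr <| Or.inl ⟨j, q, rfl, rfl⟩)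
      have htl : c (tx K n m B T S vr j q.succ) ∈
          (if q.succ = 0 then {1} else if q.succ = Fin.last (S j).card then {2} else {1, 2} :
            Finset (Fin (K + 3))) := hl (tx K n m B T S vr j q.succ)
      rw [if_neg (Fin.succ_ne_zero q)] at htl
      simp only [Finset.mem_insert, Finset.mem_singleton] at hsl
      split_ifs at htl <;> simp at htl <;> grind
  have hlast : c (tx K n m B T S vr j (Fin.last _)) ∈
      (if Fin.last (S j).card = 0 then {1}
        else if Fin.last (S j).card = Fin.last (S j).card then {2} else {1, 2} :
        Finset (Fin (K + 3))) := hl (tx K n m B T S vr j (Fin.last _))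
  rw [if_neg (by simp [Fin.ext_iff, hpos.ne']), if_pos rfl, ht, Finset.mem_singleton] at hlast
  exact h12 hlast

/-- The implication gadgets force the colors of `U_i^{j,a}` when the OR-gadget vertex
representing `a` has color `0`. -/
lemma ux_eq_target (hl : ∀ v, c v ∈ lists K n m B T S vr v)
    (hc : ∀ ⦃x y⦄, (graph K n m B T S vr).Adj x y → c x ≠ c y)
    {j : Fin m} {a : {a : Fin n → Fin B // a ∈ S j}}
    (ha : c (sx K n m B T S vr j a) = 0) (i : {i : Fin n // i ∈ vr j})
    (r : Fin ((K + 3) - (K + 3) / 2)) :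
    c (ux K n m B T S vr j a i r) = target K n B T a.1 i.1 r := by
  by_contra hne
  let c' : {c' : Fin (K + 3) // c' ≠ target K n B T a.1 i.1 r} := ⟨_, hne⟩
  have hs : c (sx K n m B T S vr j a) ≠ c (wx K n m B T S vr j a i r c' 0) :=
    ne_of_rel hc nofun
      (Or.inr <| Or.inr <| Or.inr <| Or.inl ⟨j, a, i, r, c', rfl, rfl⟩)
  have h₀₁ : c (wx K n m B T S vr j a i r c' 0) ≠ c (wx K n m B T S vr j a i r c' 1) :=
    ne_of_rel hc ((wx_injective j a i r c').ne (by decide))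
      (Or.inr <| Or.inr <| Or.inr <| Or.inr <| Or.inl ⟨j, a, i, r, c', rfl, rfl⟩)
  have h₁₂ : c (wx K n m B T S vr j a i r c' 1) ≠ c (wx K n m B T S vr j a i r c' 2) :=
    ne_of_rel hc ((wx_injective j a i r c').ne (by decide))
      (Or.inr <| Or.inr <| Or.inr <| Or.inr <| Or.inr <| Or.inl ⟨j, a, i, r, c', rfl, rfl⟩)
  have hu : c (wx K n m B T S vr j a i r c' 2) ≠ c (ux K n m B T S vr j a i r) :=
    ne_of_rel hc nofun
      (Or.inr <| Or.inr <| Or.inr <| Or.inr <| Or.inr <| Or.inr <|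
        Or.inl ⟨j, a, i, r, c', rfl, rfl⟩)
  rw [ha] at hs
  exact ne_of_weakEdge (hl (wx K n m B T S vr j a i r c' 0))
    (hl (wx K n m B T S vr j a i r c' 1)) (hl (wx K n m B T S vr j a i r c' 2))
    hs h₀₁ h₁₂ hu rfl

/-- Every color outside `T (a i)` is a target color. -/
lemma exists_target_eq (a : Fin n → Fin B) (i : Fin n) {x : Fin (K + 3)}
    (hx : x ∉ (T (a i) : Finset (Fin (K + 3)))) : ∃ r, target K n B T a i r = x := by
  let e := ((T (a i) : Finset (Fin (K + 3)))ᶜ).orderIsoOfFin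
    (k := (K + 3) - (K + 3) / 2) (by simp [Finset.card_compl, (T (a i)).2])
  obtain ⟨r, hr⟩ := e.surjective ⟨x, Finset.mem_compl.2 hx⟩
  exact ⟨r, congrArg Subtype.val hr⟩

lemma card_image_vx (hc : ∀ ⦃x y⦄, (graph K n m B T S vr).Adj x y → c x ≠ c y) (i : Fin n) :
    (Finset.univ.image fun p => c (vx K n m B T S vr i p)).card = (K + 3) / 2 := by
  rw [Finset.card_image_of_injective, Finset.card_fin]
  intro p p' h
  by_contra hp
  exact ne_of_rel hc ((vx_injective i).ne hp) (Or.inl ⟨i, p, p', hp, rfl, rfl⟩) h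

/-- The clique `V_i` uses exactly the colors of `T (a i)` when the OR-gadget vertex
representing `a` has color `0`. -/
lemma image_vx_eq (hl : ∀ v, c v ∈ lists K n m B T S vr v)
    (hc : ∀ ⦃x y⦄, (graph K n m B T S vr).Adj x y → c x ≠ c y)
    {j : Fin m} {a : {a : Fin n → Fin B // a ∈ S j}}
    (ha : c (sx K n m B T S vr j a) = 0) {i : Fin n} (hi : i ∈ vr j) :
    (Finset.univ.image fun p => c (vx K n m B T S vr i p)) = (T (a.1 i)).1 := by
  refine Finset.eq_of_subset_of_card_le ?_ (by rw [card_image_vx hc, (T (a.1 i)).2])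
  intro x hx
  obtain ⟨p, -, rfl⟩ := Finset.mem_image.1 hx
  by_contra hp
  obtain ⟨r, hr⟩ := exists_target_eq a.1 i hp
  refine ne_of_rel hc (x := ux K n m B T S vr j a ⟨i, hi⟩ r) (y := vx K n m B T S vr i p)
    nofun ?_
    ((ux_eq_target hl hc ha ⟨i, hi⟩ r).trans hr)
  exact Or.inr <| Or.inr <| Or.inr <| Or.inr <| Or.inr <| Or.inr <| Or.inr
    ⟨j, a, ⟨i, hi⟩, r, p, rfl, rfl⟩

end ProperColoring

/-- Lemma mpw2: with `k = K + 3`, `B = C(k, ⌊k/2⌋)`, `T` a bijection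
between `{1, …, B}` and the `⌊k/2⌋`-subsets of the color set, and `φ` a CSP instance
with nonempty sets of satisfying assignments: if `G(φ)` admits a proper list coloring,
then `φ` is satisfiable. -/
theorem mpw2 (hB : B = Nat.choose (K + 3) ((K + 3) / 2))
    (hS : ∀ j, (S j).Nonempty)
    (hcol : ∃ c : MVert K n m B T S vr → Fin (K + 3),
      (∀ v, c v ∈ lists K n m B T S vr v) ∧
      ∀ ⦃x y⦄, (graph K n m B T S vr).Adj x y → c x ≠ c y) :
    ∃ σ : Fin n → Fin B, Satisfies n m B S vr σ := by
  obtain ⟨c, hl, hc⟩ := hcol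
  refine ⟨fun i => T.symm ⟨_, card_image_vx hc i⟩, fun j => ?_⟩
  obtain ⟨a, ha⟩ := exists_sx_eq_zero hl hc (hS j)
  refine ⟨a.1, a.2, fun i hi => ?_⟩
  rw [Equiv.symm_apply_eq]
  exact Subtype.ext (image_vx_eq hl hc ha hi)

end Mpw
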